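/- arXiv:1904.10871 — 2 statements merged into one kernel-verified Lean document; each statement's English description precedes it below -/
import Mathlib

section
/- Let n ≥ 2 and, for j ∈ {2,…,n}, let ψ_j ∈ ℝ^n be the vector with entries (ψ_j)_i = (i−j+1)·1{i ≥ j} for i ∈ {1,…,n}. Let V ⊆ ℝ^n be the linear span of the all-ones vector and the vector (i−1)_{i=1}^n, and let ψ̄_j denote the orthogonal projection of ψ_j onto V. Then for all j ∈ {2,…,n}, ‖ψ̄_j‖₂² = ((n−j+1)²(n−j+2)²/(4n))·(1 + (n+2j−3)²/(3(n−1)(n+1))). -/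
open Finset

lemma sum_range_natCast (n : ℕ) :
    ∑ i ∈ range n, (i : ℝ) = (n : ℝ) * (n - 1) / 2 := by
  induction n with
  | zero => simp
  | succ n ih => rw [sum_range_succ, ih]; push_cast; ring

lemma sum_range_natCast_sq (n : ℕ) :
    ∑ i ∈ range n, (i : ℝ) ^ 2 = (n : ℝ) * (n - 1) * (2 * n - 1) / 6 := by
  induction n with
  | zero => simp
  | succ n ih => rw [sum_range_succ, ih]; push_cast; ring

lemma sum_range_add_ite (p m : ℕ) (f : ℕ → ℝ) :
    ∑ i ∈ range (p + m), (if p + 1 ≤ i + 1 then f i else 0) = ∑ k ∈ range m, f (p + k) := by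
  rw [sum_range_add, sum_eq_zero, zero_add]
  · exact sum_congr rfl fun k _ => if_pos (by omega)
  · exact fun i hi => if_neg (by have := mem_range.1 hi; omega)

/-- from the proof of Lemma 3.2: for `ψ_j ∈ ℝⁿ` with entries
`(ψ_j)_i = (i-j+1)·1{i ≥ j}` (1-based indices), the orthogonal projection `ψ̄_j` of
`ψ_j` onto the span `V` of the constant vector `1` and the vector `(i-1)ᵢ` satisfies
`‖ψ̄_j‖₂² = ((n-j+1)²(n-j+2)²/(4n))(1 + (n+2j-3)²/(3(n-1)(n+1)))`.
Here `i : Fin n` corresponds to the 1-based index `i + 1`, and the projection `ψ̄_j` is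
characterized by `ψ̄_j ∈ V` and `ψ_j - ψ̄_j ⊥ V`. -/
theorem stmt_18
    (n : ℕ) (hn : 2 ≤ n)
    (V : Submodule ℝ (Fin n → ℝ))
    (hV : V = Submodule.span ℝ
      {(fun _ => 1 : Fin n → ℝ), (fun i => ((i : ℕ) : ℝ) : Fin n → ℝ)})
    (j : ℕ) (hj1 : 2 ≤ j) (hj2 : j ≤ n)
    (ψ : Fin n → ℝ)
    (hψ : ψ = fun i : Fin n => if j ≤ (i : ℕ) + 1 then ((i : ℕ) : ℝ) - j + 2 else 0)
    (ψbar : Fin n → ℝ)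
    (hmem : ψbar ∈ V)
    (horth : ∀ g ∈ V, (∑ i, (ψ i - ψbar i) * g i) = 0) :
    (∑ i, ψbar i ^ 2) =
      (((n : ℝ) - j + 1) ^ 2 * ((n : ℝ) - j + 2) ^ 2 / (4 * n)) *
        (1 + ((n : ℝ) + 2 * j - 3) ^ 2 / (3 * ((n : ℝ) - 1) * ((n : ℝ) + 1))) := by
  subst hV
  obtain ⟨a, b, hab⟩ := Submodule.mem_span_pair.1 hmem
  have hbar : ∀ i : Fin n, ψbar i = a + b * ((i : ℕ) : ℝ) := fun i => by
    simp [← hab]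
  have horth_one := horth _ (Submodule.subset_span (Set.mem_insert _ _))
  have horth_id := horth _ (Submodule.subset_span (Set.mem_insert_of_mem _ rfl))
  subst hψ
  simp only [hbar] at horth_one horth_id ⊢
  rw [Fin.sum_univ_eq_sum_range (fun i => ((if j ≤ i + 1 then (i : ℝ) - j + 2 else 0)
    - (a + b * (i : ℝ))) * 1)] at horth_one
  rw [Fin.sum_univ_eq_sum_range (fun i => ((if j ≤ i + 1 then (i : ℝ) - j + 2 else 0)
    - (a + b * (i : ℝ))) * (i : ℝ))] at horth_id
  rw [Fin.sum_univ_eq_sum_range (fun i => (a + b * (i : ℝ)) ^ 2)]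
  obtain ⟨p, rfl⟩ : ∃ p, j = p + 1 := ⟨j - 1, by omega⟩
  obtain ⟨m, rfl⟩ : ∃ m, n = p + m := ⟨n - p, by omega⟩
  have hnorm : ∑ i ∈ range (p + m), (a + b * (i : ℝ)) ^ 2 =
      a ^ 2 * ((p + m : ℕ) : ℝ) + 2 * a * b * ∑ i ∈ range (p + m), (i : ℝ)
        + b ^ 2 * ∑ i ∈ range (p + m), (i : ℝ) ^ 2 := by
    simp only [add_sq, mul_pow, sum_add_distrib, mul_sum, sum_const, card_range, nsmul_eq_mul]
    congr 1
    congr 1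
    · ring
    · exact sum_congr rfl fun _ _ => by ring
  have hψ_one : ∑ i ∈ range (p + m),
      (if p + 1 ≤ i + 1 then (i : ℝ) - ((p + 1 : ℕ) : ℝ) + 2 else 0) = (m : ℝ) * (m + 1) / 2 := by
    rw [sum_range_add_ite p m (fun i => (i : ℝ) - ((p + 1 : ℕ) : ℝ) + 2)]
    calc _ = ∑ k ∈ range m, ((k : ℝ) + 1) :=
          sum_congr rfl fun _ _ => by push_cast; ring
      _ = _ := by
        rw [sum_add_distrib, sum_range_natCast]
        simp only [sum_const, card_range, nsmul_eq_mul]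
        ring
  have hψ_id : ∑ i ∈ range (p + m),
      (if p + 1 ≤ i + 1 then ((i : ℝ) - ((p + 1 : ℕ) : ℝ) + 2) * (i : ℝ) else 0) =
        (m : ℝ) * (m + 1) / 2 * ((2 * m + 1) / 3 + p - 1) := by
    rw [sum_range_add_ite p m (fun i => ((i : ℝ) - ((p + 1 : ℕ) : ℝ) + 2) * (i : ℝ))]
    calc _ = ∑ k ∈ range m, ((k : ℝ) ^ 2 + (p + 1) * (k : ℝ) + p) :=
          sum_congr rfl fun _ _ => by push_cast; ring
      _ = _ := by
        rw [sum_add_distrib, sum_add_distrib, ← mul_sum, sum_range_natCast,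
          sum_range_natCast_sq]
        simp only [sum_const, card_range, nsmul_eq_mul]
        ring
  simp only [mul_one, sum_sub_distrib, hψ_one, sum_add_distrib, ← mul_sum,
    sum_range_natCast, sum_const, card_range, nsmul_eq_mul] at horth_one
  have hid : ∑ i ∈ range (p + m),
      (if p + 1 ≤ i + 1 then ((i : ℝ) - ((p + 1 : ℕ) : ℝ) + 2) * (i : ℝ) else 0) -
        (a * ∑ i ∈ range (p + m), (i : ℝ) + b * ∑ i ∈ range (p + m), (i : ℝ) ^ 2) = 0 := by
    refine Eq.trans ?_ horth_id
    rw [mul_sum, mul_sum, ← sum_add_distrib, ← sum_sub_distrib]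
    exact sum_congr rfl fun _ _ => by split_ifs <;> ring
  rw [hψ_id, sum_range_natCast, sum_range_natCast_sq] at hid
  rw [hnorm, sum_range_natCast, sum_range_natCast_sq]
  have hn' : (2 : ℝ) ≤ (p : ℝ) + m := by exact_mod_cast hn
  push_cast at horth_one hid ⊢
  obtain ⟨N, hN⟩ : ∃ N : ℝ, (p : ℝ) + m = N := ⟨_, rfl⟩
  have hp : (p : ℝ) = N - m := by linarith
  rw [hN] at horth_one hid hn' ⊢
  rw [hp] at hid ⊢
  generalize (m : ℝ) = M at horth_one hid ⊢
  have h0 : N ≠ 0 := by linarith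
  have h1 : N - 1 ≠ 0 := by intro h; linarith
  have h2 : N + 1 ≠ 0 := by intro h; linarith
  have hb : b = M * (M + 1) * (3 * N - 2 * M - 1) / (N * (N - 1) * (N + 1)) := by
    rw [eq_div_iff (by positivity)]
    linear_combination (-12) * hid + 6 * (N - 1) * horth_one
  have ha : a = M * (M + 1) / (2 * N) - (N - 1) / 2 * b := by
    field_simp
    linear_combination (-2) * horth_one
  rw [ha, hb]
  field_simp
  ring
end

section
/- Let n ≥ 3 and let ψ₃ ∈ ℝ^n be the vector with entries (ψ₃)_i = (i−1)(i−2)/2 for i ∈ {1,…,n}. Let V ⊆ ℝ^n be the linear span of the all-ones vector and the vector (i−1)_{i=1}^n, and let u₃ := ψ₃ − P_V ψ₃ be the orthogonal projection of ψ₃ onto the orthogonal complement of V. Then u₃ has entries (u₃)_i = (i−1)(i−n)/2 + (n−1)(n−2)/12 for i ∈ {1,…,n}, and ‖u₃‖₂² = (n+2)(n+1)n(n−1)(n−2)/720. -/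
open Finset

/-- Closed form for the sum of a polynomial of degree at most four over `0, …, n - 1`. -/
lemma sum_quartic (n : ℕ) (a b c d e : ℝ) :
    ∑ i : Fin n, (a + b * ((i : ℕ) : ℝ) + c * ((i : ℕ) : ℝ) ^ 2 + d * ((i : ℕ) : ℝ) ^ 3
        + e * ((i : ℕ) : ℝ) ^ 4) =
      a * n + b * (n * (n - 1) / 2) + c * (n * (n - 1) * (2 * n - 1) / 6)
        + d * (n ^ 2 * (n - 1) ^ 2 / 4)
        + e * (n * (n - 1) * (2 * n - 1) * (3 * n ^ 2 - 3 * n - 1) / 30) := by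
  induction n with
  | zero => simp
  | succ n ih =>
    rw [Fin.sum_univ_castSucc]
    simp only [Fin.val_castSucc, Fin.val_last]
    rw [ih]
    push_cast
    ring

/-- The quadratic `i (i + 1 - n) / 2 + (n - 1) (n - 2) / 12` is orthogonal to affine sequences
on `0, …, n - 1`. -/
lemma sum_quadratic_mul_affine (n : ℕ) (a b : ℝ) :
    ∑ i : Fin n, (((i : ℕ) : ℝ) * (((i : ℕ) : ℝ) + 1 - n) / 2
        + ((n : ℝ) - 1) * ((n : ℝ) - 2) / 12) * (a + b * ((i : ℕ) : ℝ)) = 0 := by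
  have h := sum_quartic n (((n : ℝ) - 1) * (n - 2) / 12 * a)
    ((1 - n) / 2 * a + ((n : ℝ) - 1) * (n - 2) / 12 * b) (a / 2 + (1 - n) / 2 * b) (b / 2) 0
  refine (Finset.sum_congr rfl fun i _ => ?_).trans (h.trans ?_) <;> ring

lemma sum_quadratic_sq (n : ℕ) :
    ∑ i : Fin n, (((i : ℕ) : ℝ) * (((i : ℕ) : ℝ) + 1 - n) / 2
        + ((n : ℝ) - 1) * ((n : ℝ) - 2) / 12) ^ 2 =
      ((n : ℝ) + 2) * ((n : ℝ) + 1) * (n : ℝ) * ((n : ℝ) - 1) * ((n : ℝ) - 2) / 720 := by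
  have h := sum_quartic n ((((n : ℝ) - 1) * (n - 2) / 12) ^ 2)
    ((1 - n) * (((n : ℝ) - 1) * (n - 2) / 12))
    (((n : ℝ) - 1) * (n - 2) / 12 + (1 - n) ^ 2 / 4) ((1 - n) / 2) (1 / 4)
  refine (Finset.sum_congr rfl fun i _ => ?_).trans (h.trans ?_) <;> ring

/-- from the proof of Lemma 3.3: for `ψ₃ ∈ ℝⁿ` with entries
`(ψ₃)_i = (i-1)(i-2)/2` (1-based indices), the anti-projection
`u₃ = ψ₃ - P_V ψ₃` of `ψ₃` with respect to the span `V` of the constant vector `1` and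
the vector `(i-1)ᵢ` has entries `(u₃)_i = (i-1)(i-n)/2 + (n-1)(n-2)/12` and
`‖u₃‖₂² = (n+2)(n+1)n(n-1)(n-2)/720`.
Here `i : Fin n` corresponds to the 1-based index `i + 1`, and `P_V ψ₃` is
characterized as the element `p ∈ V` with `ψ₃ - p ⊥ V`. -/
theorem stmt_19
    (n : ℕ) (hn : 3 ≤ n)
    (V : Submodule ℝ (Fin n → ℝ))
    (hV : V = Submodule.span ℝ
      {(fun _ => 1 : Fin n → ℝ), (fun i => ((i : ℕ) : ℝ) : Fin n → ℝ)})
    (ψ₃ : Fin n → ℝ)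
    (hψ₃ : ψ₃ = fun i : Fin n => ((i : ℕ) : ℝ) * (((i : ℕ) : ℝ) - 1) / 2)
    (p : Fin n → ℝ)
    (hmem : p ∈ V)
    (horth : ∀ g ∈ V, (∑ i, (ψ₃ i - p i) * g i) = 0) :
    (∀ i : Fin n, ψ₃ i - p i =
      ((i : ℕ) : ℝ) * (((i : ℕ) : ℝ) + 1 - n) / 2 + ((n : ℝ) - 1) * ((n : ℝ) - 2) / 12) ∧
    (∑ i, (ψ₃ i - p i) ^ 2) =
      ((n : ℝ) + 2) * ((n : ℝ) + 1) * (n : ℝ) * ((n : ℝ) - 1) * ((n : ℝ) - 2) / 720 := by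
  have hentries : ∀ i : Fin n, ψ₃ i - p i =
      ((i : ℕ) : ℝ) * (((i : ℕ) : ℝ) + 1 - n) / 2 + ((n : ℝ) - 1) * ((n : ℝ) - 2) / 12 := by
    rw [hV] at hmem
    obtain ⟨a, b, hp⟩ := Submodule.mem_span_pair.1 hmem
    have hpi (i : Fin n) : p i = a + b * ((i : ℕ) : ℝ) := by simp [← hp]
    set α : ℝ := -a - ((n : ℝ) - 1) * (n - 2) / 12 with hα
    set β : ℝ := ((n : ℝ) - 2) / 2 - b with hβ
    have hdiff (i : Fin n) : ψ₃ i - p i = (((i : ℕ) : ℝ) * (((i : ℕ) : ℝ) + 1 - n) / 2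
        + ((n : ℝ) - 1) * ((n : ℝ) - 2) / 12) + (α + β * ((i : ℕ) : ℝ)) := by
      rw [hpi, hψ₃, hα, hβ]
      ring
    have horth' : ∑ i : Fin n, (ψ₃ i - p i) * (α + β * ((i : ℕ) : ℝ)) = 0 := by
      refine horth (fun i => α + β * ((i : ℕ) : ℝ)) ?_
      rw [hV]
      exact Submodule.mem_span_pair.2 ⟨α, β, by ext i; simp⟩
    have hsq : ∑ i : Fin n, (α + β * ((i : ℕ) : ℝ)) ^ 2 = 0 := by
      rw [← horth', ← zero_add (∑ i : Fin n, (α + β * ((i : ℕ) : ℝ)) ^ 2),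
        ← sum_quadratic_mul_affine n α β, ← Finset.sum_add_distrib]
      refine Finset.sum_congr rfl fun i _ => ?_
      rw [hdiff]
      ring
    intro i
    have hi := (Finset.sum_eq_zero_iff_of_nonneg fun i _ => sq_nonneg _).1 hsq i (mem_univ i)
    rw [hdiff, pow_eq_zero_iff two_ne_zero |>.1 hi, add_zero]
  refine ⟨hentries, ?_⟩
  simp only [hentries]
  exact sum_quadratic_sq n
end
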